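/- Composition of noncontextual hidden-variable models: Suppose p_{B|Y}(β,y) = Σ_γ p_Γ(γ) Π_{i∈B} δ(β_i, g_i(y_(i),γ)), p_{A|X}(α,β) = Σ_λ p_Λ(λ) Π_{k∈A} δ(α_k, h_k(β_(k),λ)), and p_{C|Z,β,y}(c,α) = Σ_φ p_Φ(φ) Π_{j∈C} δ(c_j, f_j(α_(j), β_[j], y_[j], φ)), where p_Γ, p_Λ, p_Φ are probability distributions on finite sets and g_i, h_k, f_j are deterministic response functions. Then the wired behavior p_{C|Y}(c,y) = Σ_{α,β} p_{C|Z,β,y}(c,α) p_{A|X}(α,β) p_{B|Y}(β,y) equals Σ_{(γ,λ,φ)} p_Γ(γ) p_Λ(λ) p_Φ(φ) Π_{j∈C} δ(c_j, F_j(y_[j], (γ,λ,φ))), where F_j(y_[j],(γ,λ,φ)) := f_j( ᾱ_(j)(β̄_[j](y_[j],γ), λ), β̄_[j](y_[j],γ), y_[j], φ ), with β̄_[j](y_[j],γ) the deterministic output substring of the pre-processing box on the lights corresponding to X_[j] (a function of y_[j] and γ only) and ᾱ_(j)(·,λ) the deterministic output substring of the initial box on the lights corresponding to Z_(j). In particular,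 the wired behavior admits a noncontextual hidden-variable model with hidden variable (γ,λ,φ) distributed as the product p_Γ p_Λ p_Φ. -/

import Mathlib

open scoped BigOperators

set_option maxHeartbeats 1000000

/-- Summing a function against a finite mixture of deterministic behaviors averages its values
at the deterministic outputs. -/
theorem sum_mul_deterministic_mixture {ι Γ : Type*} [Fintype ι] [DecidableEq ι] [Fintype Γ]
    (p : Γ → ℝ) (b : Γ → ι → Bool) (G : (ι → Bool) → ℝ) :
    ∑ β : ι → Bool, G β * ∑ γ, p γ * ∏ i, (if β i = b γ i then (1 : ℝ) else 0)
      = ∑ γ, p γ * G (b γ) := by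
  simp_rw [Finset.mul_sum]
  rw [Finset.sum_comm]
  refine Finset.sum_congr rfl fun γ _ => ?_
  simp [Finset.prod_boole, ← funext_iff, mul_comm]

/-- **Composition of noncontextual hidden-variable models.**
Suppose the pre-processing behavior `PB`, the initial behavior `PA` and the
post-processing behaviors `PC` are given by noncontextual deterministic
hidden-variable models with hidden variables `γ : Fin nG`, `lam : Fin nL`,
`φ : Fin nF` and response functions `g`, `h`, `f` (each depending only on the
appropriate substring of its inputs, as dictated by the hypergraphs `OB`,
`OAh`, `OCh`).  Then the wired behavior
`p_{C|Y}(c,y) = Σ_{α,β} PC β y α c · PA β α · PB y β` equals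
`Σ_{γ,lam,φ} pG γ · pL lam · pF φ · Π_j δ(c_j, F_j(y,(γ,lam,φ)))`, where
`F_j(y,(γ,lam,φ)) = f j (ᾱ_(j)(β̄(y,γ),lam)) (β̄(y,γ)) y φ` with
`β̄(y,γ) = fun i => g i y γ` the deterministic output of the pre-processing box
and `ᾱ(β,lam) = fun k => h k β lam` the deterministic output of the initial
box; in particular each `F_j` depends only on the substring `y_[j]` of `y`, so
the wired behavior admits a noncontextual hidden-variable model with hidden
variable `(γ,lam,φ)` distributed as the product `pG · pL · pF`. -/
theorem composition_of_noncontextual_models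
    {bX lA mY cC nG nL nF : ℕ}
    (OB : Fin mY → Fin bX → Bool)
    (OAh : Fin bX → Fin lA → Bool)
    (OCh : Fin lA → Fin cC → Bool)
    (pG : Fin nG → ℝ) (pL : Fin nL → ℝ) (pF : Fin nF → ℝ)
    (g : Fin bX → (Fin mY → Bool) → Fin nG → Bool)
    (h : Fin lA → (Fin bX → Bool) → Fin nL → Bool)
    (f : Fin cC → (Fin lA → Bool) → (Fin bX → Bool) →
         (Fin mY → Bool) → Fin nF → Bool)
    (PB : (Fin mY → Bool) → (Fin bX → Bool) → ℝ)
    (PA : (Fin bX → Bool) → (Fin lA → Bool) → ℝ)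
    (PC : (Fin bX → Bool) → (Fin mY → Bool) →
          (Fin lA → Bool) → (Fin cC → Bool) → ℝ)
    (hpG : (∀ γ, 0 ≤ pG γ) ∧ (∑ γ, pG γ) = 1)
    (hpL : (∀ lam, 0 ≤ pL lam) ∧ (∑ lam, pL lam) = 1)
    (hpF : (∀ φ, 0 ≤ pF φ) ∧ (∑ φ, pF φ) = 1)
    (hg : ∀ i γ y y', (∀ u, OB u i = true → y u = y' u) → g i y γ = g i y' γ)
    (hg0 : ∀ i γ, g i (fun _ => false) γ = false)
    (hh : ∀ k lam β β', (∀ i, OAh i k = true → β i = β' i) →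
            h k β lam = h k β' lam)
    (hh0 : ∀ k lam, h k (fun _ => false) lam = false)
    (hf : ∀ j φ z z' β β' y y',
       (∀ k, OCh k j = true → z k = z' k) →
       (∀ i', (∃ k, OCh k j = true ∧ OAh i' k = true) → β i' = β' i') →
       (∀ u, (∃ i', (∃ k, OCh k j = true ∧ OAh i' k = true) ∧
               OB u i' = true) → y u = y' u) →
       f j z β y φ = f j z' β' y' φ)
    (hf0 : ∀ j φ β y, f j (fun _ => false) β y φ = false)
    (hPB : ∀ y β, PB y β = ∑ γ, pG γ * ∏ i, (if β i = g i y γ then (1:ℝ) else 0))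
    (hPA : ∀ β α, PA β α = ∑ lam, pL lam * ∏ k, (if α k = h k β lam then (1:ℝ) else 0))
    (hPC : ∀ β y z cc, PC β y z cc =
             ∑ φ, pF φ * ∏ j, (if cc j = f j z β y φ then (1:ℝ) else 0)) :
    (∀ (y : Fin mY → Bool) (cc : Fin cC → Bool),
      (∑ β : Fin bX → Bool, ∑ α : Fin lA → Bool, PC β y α cc * PA β α * PB y β)
        = ∑ γ, ∑ lam, ∑ φ, pG γ * pL lam * pF φ *
            ∏ j, (if cc j = f j (fun k => h k (fun i => g i y γ) lam)
                              (fun i => g i y γ) y φ then (1:ℝ) else 0)) ∧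
    (∀ j γ lam φ (y y' : Fin mY → Bool),
      (∀ u, (∃ i', (∃ k, OCh k j = true ∧ OAh i' k = true) ∧
              OB u i' = true) → y u = y' u) →
      f j (fun k => h k (fun i => g i y γ) lam) (fun i => g i y γ) y φ
        = f j (fun k => h k (fun i => g i y' γ) lam) (fun i => g i y' γ) y' φ) := by
  refine ⟨fun y cc => ?_, fun j γ lam φ y y' hy => ?_⟩
  · have sum_initial (β : Fin bX → Bool) :
        ∑ α, PC β y α cc * PA β α
          = ∑ lam, pL lam * PC β y (fun k => h k β lam) cc := by
      simp_rw [hPA]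
      exact sum_mul_deterministic_mixture pL (fun lam k => h k β lam) fun α => PC β y α cc
    simp_rw [← Finset.sum_mul, sum_initial, hPB]
    rw [sum_mul_deterministic_mixture pG (fun γ i => g i y γ)
      fun β => ∑ lam, pL lam * PC β y (fun k => h k β lam) cc]
    simp_rw [hPC, Finset.mul_sum, mul_assoc]
  · have g_eq (i : Fin bX) (hi : ∃ k, OCh k j = true ∧ OAh i k = true) :
        g i y γ = g i y' γ :=
      hg i γ y y' fun u hu => hy u ⟨i, hi, hu⟩
    exact hf j φ _ _ _ _ y y'
      (fun k hk => hh k lam _ _ fun i hi => g_eq i ⟨k, hk, hi⟩) g_eq hy
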